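/- Let t, t' ∈ [0,1] with t ≠ t'. Then the maps f_t and f_{t'} are inequivalent: there do not exist automorphisms τ of Ω^I_{2,2} and σ of Ω^I_{4,4} such that f_t(Z) = σ(f_{t'}(τ(Z))) for all Z ∈ Ω^I_{2,2}. -/

import Mathlib

open Matrix
open scoped ComplexOrder

noncomputable section

attribute [local instance] Matrix.normedAddCommGroup Matrix.normedSpace

/-- The type I classical bounded symmetric domain `Ω^I_{r,s}`. -/
def OmegaI (r s : ℕ) : Set (Matrix (Fin r) (Fin s) ℂ) :=
  {Z | (1 - Z * Zᴴ).PosDef}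

/-- `τ` is an automorphism of the domain `Ω`: a holomorphic bijection of `Ω` onto itself
with holomorphic inverse. -/
def IsAutomorphismOf {E : Type*} [NormedAddCommGroup E] [NormedSpace ℂ E]
    (Ω : Set E) (τ : E → E) : Prop :=
  Set.MapsTo τ Ω Ω ∧ DifferentiableOn ℂ τ Ω ∧
    ∃ τinv : E → E, Set.MapsTo τinv Ω Ω ∧ DifferentiableOn ℂ τinv Ω ∧
      (∀ z ∈ Ω, τinv (τ z) = z) ∧ (∀ z ∈ Ω, τ (τinv z) = z)

/-- The one-parameter family `f_t : Ω^I_{2,2} → Ω^I_{4,4}` of equation (4.1). -/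
def ft (t : ℝ) (Z : Matrix (Fin 2) (Fin 2) ℂ) : Matrix (Fin 4) (Fin 4) ℂ :=
  !![Z 0 0 ^ 2, (Real.sqrt (2 - t) : ℂ) * Z 0 0 * Z 0 1,
      (Real.sqrt (1 - t) : ℂ) * Z 0 1 ^ 2, (Real.sqrt t : ℂ) * Z 0 1;
    (Real.sqrt (2 - t) : ℂ) * Z 0 0 * Z 1 0,
      ((2 * (1 - t) / (2 - t) : ℝ) : ℂ) * Z 0 0 * Z 1 1 + Z 0 1 * Z 1 0,
      ((2 * Real.sqrt ((1 - t) / (2 - t)) : ℝ) : ℂ) * Z 0 1 * Z 1 1,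
      (Real.sqrt (t / (2 - t)) : ℂ) * Z 1 1;
    (Real.sqrt (1 - t) : ℂ) * Z 1 0 ^ 2,
      ((2 * Real.sqrt ((1 - t) / (2 - t)) : ℝ) : ℂ) * Z 1 0 * Z 1 1, Z 1 1 ^ 2, 0;
    (Real.sqrt t : ℂ) * Z 1 0, (Real.sqrt (t / (2 - t)) : ℂ) * Z 1 1, 0, 0]

theorem mem_OmegaI_iff {r s : ℕ} {Z : Matrix (Fin r) (Fin s) ℂ} :
    Z ∈ OmegaI r s ↔ ∀ x : Fin r → ℂ, x ≠ 0 → ∑ j, ‖(x ᵥ* Z) j‖ ^ 2 < ∑ i, ‖x i‖ ^ 2 := by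
  have hsq {n : ℕ} (y : Fin n → ℂ) : y ⬝ᵥ star y = ((∑ i, ‖y i‖ ^ 2 : ℝ) : ℂ) := by
    simp [dotProduct, Complex.mul_conj']
  have key (x : Fin r → ℂ) : x ⬝ᵥ ((1 - Z * Zᴴ) *ᵥ star x) =
      ((∑ i, ‖x i‖ ^ 2 - ∑ j, ‖(x ᵥ* Z) j‖ ^ 2 : ℝ) : ℂ) := by
    rw [Complex.ofReal_sub, ← hsq, ← hsq, sub_mulVec, dotProduct_sub, one_mulVec,
      ← mulVec_mulVec, dotProduct_mulVec x Z, star_vecMul]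
  have hherm : (1 - Z * Zᴴ).IsHermitian := by
    simp [IsHermitian, conjTranspose_mul]
  rw [OmegaI, Set.mem_ofPred_eq, posDef_iff_dotProduct_mulVec]
  refine ⟨fun h x hx => ?_, fun h => ⟨hherm, fun x hx => ?_⟩⟩
  · have := h.2 (star_ne_zero.2 hx)
    rw [star_star, key, Complex.zero_lt_real] at this
    linarith
  · have := h (star x) (star_ne_zero.2 hx)
    have k := key (star x)
    rw [star_star] at k
    rw [k, Complex.zero_lt_real]
    linarith

theorem smul_mem_OmegaI {r s : ℕ} {W : Matrix (Fin r) (Fin s) ℂ}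
    (hW : ∀ x : Fin r → ℂ, ∑ j, ‖(x ᵥ* W) j‖ ^ 2 ≤ ∑ i, ‖x i‖ ^ 2)
    {ζ : ℂ} (hζ : ζ ∈ Metric.ball (0 : ℂ) 1) : ζ • W ∈ OmegaI r s := by
  rw [mem_OmegaI_iff]
  intro x hx
  have hpos : 0 < ∑ i, ‖x i‖ ^ 2 := by
    obtain ⟨i, hi⟩ := Function.ne_iff.1 hx
    exact Finset.sum_pos' (fun _ _ => by positivity)
      ⟨i, Finset.mem_univ _, pow_pos (norm_pos_iff.2 hi) 2⟩
  have hζ' : ‖ζ‖ ^ 2 < 1 := by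
    rw [mem_ball_zero_iff] at hζ
    exact pow_lt_one₀ (norm_nonneg _) hζ two_ne_zero
  calc ∑ j, ‖(x ᵥ* (ζ • W)) j‖ ^ 2 = ‖ζ‖ ^ 2 * ∑ j, ‖(x ᵥ* W) j‖ ^ 2 := by
        simp [vecMul_smul, mul_pow, Finset.mul_sum]
    _ ≤ ‖ζ‖ ^ 2 * ∑ i, ‖x i‖ ^ 2 := by gcongr; exact hW x
    _ < ∑ i, ‖x i‖ ^ 2 := by nlinarith

/-- The Schwarz lemma for holomorphic discs in `Ω^I_{r,s}` centred at the origin. -/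
theorem schwarz_OmegaI {r s : ℕ} {g : ℂ → Matrix (Fin r) (Fin s) ℂ}
    {V : Matrix (Fin r) (Fin s) ℂ} (hd : DifferentiableOn ℂ g (Metric.ball 0 1))
    (hm : Set.MapsTo g (Metric.ball 0 1) (OmegaI r s)) (h0 : g 0 = 0) (hV : HasDerivAt g V 0)
    (x : Fin r → ℂ) : ∑ j, ‖(x ᵥ* V) j‖ ^ 2 ≤ ∑ i, ‖x i‖ ^ 2 := by
  let L : Matrix (Fin r) (Fin s) ℂ →ₗ[ℂ] EuclideanSpace ℂ (Fin s) :=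
    { toFun := fun Z => WithLp.toLp 2 (x ᵥ* Z)
      map_add' := fun Y Z => by rw [vecMul_add]; rfl
      map_smul' := fun c Z => by rw [vecMul_smul]; rfl }
  have hL (Z) : ‖L.toContinuousLinearMap Z‖ = √(∑ j, ‖(x ᵥ* Z) j‖ ^ 2) := by
    rw [EuclideanSpace.norm_eq]; rfl
  have hderiv := (L.toContinuousLinearMap.hasFDerivAt.comp_hasDerivAt (0 : ℂ) hV).deriv
  have := Complex.norm_deriv_le_div_of_mapsTo_ball (f := L.toContinuousLinearMap ∘ g) (c := 0)
    (R₁ := 1) (R₂ := √(∑ i, ‖x i‖ ^ 2))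
    (L.toContinuousLinearMap.differentiable.comp_differentiableOn hd) ?_ one_pos
  · rw [hderiv, div_one] at this
    exact (Real.sqrt_le_sqrt_iff (by positivity)).1 ((hL V).symm.trans_le this)
  · intro ζ hζ
    have hx := mem_OmegaI_iff.1 (hm hζ) x
    rw [Function.comp_apply, h0, map_zero, mem_closedBall_zero_iff, Function.comp_apply, hL]
    apply Real.sqrt_le_sqrt
    rcases eq_or_ne x 0 with rfl | hx0
    · simp
    · exact (hx hx0).le

theorem vecMul_sq_lt {Z : Matrix (Fin 2) (Fin 2) ℂ} (hZ : Z ∈ OmegaI 2 2) {a b : ℂ}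
    (h : a ≠ 0 ∨ b ≠ 0) :
    ‖a * Z 0 0 + b * Z 1 0‖ ^ 2 + ‖a * Z 0 1 + b * Z 1 1‖ ^ 2 < ‖a‖ ^ 2 + ‖b‖ ^ 2 := by
  have := mem_OmegaI_iff.1 hZ ![a, b] (fun h' => by
    have h0 := congrFun h' 0
    have h1 := congrFun h' 1
    simp at h0 h1
    tauto)
  simpa [Fin.sum_univ_two, vecMul, dotProduct] using this

theorem vecMul_sq_le {Z : Matrix (Fin 2) (Fin 2) ℂ} (hZ : Z ∈ OmegaI 2 2) (a b : ℂ) :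
    ‖a * Z 0 0 + b * Z 1 0‖ ^ 2 + ‖a * Z 0 1 + b * Z 1 1‖ ^ 2 ≤ ‖a‖ ^ 2 + ‖b‖ ^ 2 := by
  by_cases h : a ≠ 0 ∨ b ≠ 0
  · exact (vecMul_sq_lt hZ h).le
  · push Not at h
    simp [h.1, h.2]

/-- Cauchy-Schwarz for a real linear combination of two complex numbers. -/
theorem norm_add_sq_le (α β : ℝ) (u v : ℂ) :
    ‖(α : ℂ) * u + β * v‖ ^ 2 ≤ (α ^ 2 + β ^ 2) * (‖u‖ ^ 2 + ‖v‖ ^ 2) := by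
  simp only [Complex.sq_norm, Complex.normSq_apply, Complex.add_re, Complex.add_im,
    Complex.mul_re, Complex.mul_im, Complex.ofReal_re, Complex.ofReal_im]
  nlinarith [sq_nonneg (α * v.re - β * u.re), sq_nonneg (α * v.im - β * u.im)]

theorem sqrt_div_two_sub {a t : ℝ} (ha : 0 ≤ a) : √(a / (2 - t)) = √a / √(2 - t) :=
  Real.sqrt_div ha _

/-- `f_t` maps `Ω^I_{2,2}` into `Ω^I_{4,4}`: acting on row vectors, `f_t(Z)` is a composition of
contractions, two of which multiply pairs of coordinates by `Z`. -/
theorem ft_mapsTo {t : ℝ} (ht : t ∈ Set.Icc (0 : ℝ) 1) :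
    Set.MapsTo (ft t) (OmegaI 2 2) (OmegaI 4 4) := by
  intro Z hZ
  rw [mem_OmegaI_iff]
  intro x hx
  obtain ⟨ht0, ht1⟩ := ht
  set p := √(2 - t) with hp
  set q := √(1 - t) with hq
  set w := √t with hw
  have hp2 : p ^ 2 = 2 - t := Real.sq_sqrt (by linarith)
  have hq2 : q ^ 2 = 1 - t := Real.sq_sqrt (by linarith)
  have hw2 : w ^ 2 = t := Real.sq_sqrt ht0
  have hp0 : 0 < p := Real.sqrt_pos.2 (by linarith)
  obtain ⟨α, hα⟩ : ∃ α : ℝ, α = 1 / p := ⟨_, rfl⟩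
  obtain ⟨β, hβ⟩ : ∃ β : ℝ, β = q / p := ⟨_, rfl⟩
  have hαβ : α ^ 2 + β ^ 2 = 1 := by
    rw [hα, hβ]; field_simp; rw [hp2, hq2]; ring
  have e1 : p = α + β * q := by
    rw [hα, hβ]; field_simp; rw [hp2, hq2]; ring
  have e2 : √((1 - t) / (2 - t)) = β := by rw [sqrt_div_two_sub (by linarith), hβ]
  have e3 : √(t / (2 - t)) = α * w := by rw [sqrt_div_two_sub ht0, hα]; ring
  have e4 : 2 * (1 - t) / (2 - t) = 2 * β ^ 2 := by
    rw [hβ, div_pow, hp2, hq2]; ring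
  have e5 : β = α * q := by rw [hα, hβ]; ring
  have hqw : q ^ 2 + w ^ 2 = 1 := by rw [hq2, hw2]; ring
  obtain ⟨x0, hx0⟩ : ∃ y, y = x 0 := ⟨_, rfl⟩
  obtain ⟨x1, hx1⟩ : ∃ y, y = x 1 := ⟨_, rfl⟩
  obtain ⟨x2, hx2⟩ : ∃ y, y = x 2 := ⟨_, rfl⟩
  obtain ⟨x3, hx3⟩ : ∃ y, y = x 3 := ⟨_, rfl⟩
  obtain ⟨b11, hb11⟩ : ∃ y, y = x0 * Z 0 0 + α * x1 * Z 1 0 := ⟨_, rfl⟩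
  obtain ⟨b12, hb12⟩ : ∃ y, y = x0 * Z 0 1 + α * x1 * Z 1 1 := ⟨_, rfl⟩
  obtain ⟨b21, hb21⟩ : ∃ y, y = β * x1 * Z 0 0 + x2 * Z 1 0 := ⟨_, rfl⟩
  obtain ⟨b22, hb22⟩ : ∃ y, y = β * x1 * Z 0 1 + x2 * Z 1 1 := ⟨_, rfl⟩
  obtain ⟨c21, hc21⟩ : ∃ y : ℂ, y = q * b21 + w * x3 := ⟨_, rfl⟩
  obtain ⟨d11, hd11⟩ : ∃ y, y = b11 * Z 0 0 + c21 * Z 1 0 := ⟨_, rfl⟩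
  obtain ⟨d21, hd21⟩ : ∃ y, y = b11 * Z 0 1 + c21 * Z 1 1 := ⟨_, rfl⟩
  obtain ⟨d12, hd12⟩ : ∃ y, y = q * b12 * Z 0 0 + b22 * Z 1 0 := ⟨_, rfl⟩
  obtain ⟨d22, hd22⟩ : ∃ y, y = q * b12 * Z 0 1 + b22 * Z 1 1 := ⟨_, rfl⟩
  have hαβC : (α : ℂ) ^ 2 + β ^ 2 = 1 := by exact_mod_cast hαβ
  have e5C : (β : ℂ) = α * q := by exact_mod_cast e5
  have hqwC : (q : ℂ) ^ 2 + w ^ 2 = 1 := by exact_mod_cast hqw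
  have o0 : (x ᵥ* ft t Z) 0 = d11 := by
    simp [vecMul, dotProduct, Fin.sum_univ_four, ft, ← hp, ← hq, ← hw, e2, e3, e4,
      ← hx0, ← hx1, ← hx2, ← hx3]
    rw [hd11, hb11, hc21, hb21, e1]; push_cast; ring
  have o1 : (x ᵥ* ft t Z) 1 = α * d21 + β * d12 := by
    simp [vecMul, dotProduct, Fin.sum_univ_four, ft, ← hp, ← hq, ← hw, e2, e3, e4,
      ← hx0, ← hx1, ← hx2, ← hx3]
    rw [hd21, hd12, hb11, hc21, hb21, hb12, hb22, e1]; push_cast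
    linear_combination (- x1 * Z 0 1 * Z 1 0) * hαβC +
      (x2 * Z 1 0 * Z 1 1 + 2 * x1 * Z 0 0 * Z 1 1 * β) * e5C
  have o2 : (x ᵥ* ft t Z) 2 = d22 := by
    simp [vecMul, dotProduct, Fin.sum_univ_four, ft, ← hp, ← hq, ← hw, e2, e3, e4,
      ← hx0, ← hx1, ← hx2, ← hx3]
    rw [hd22, hb12, hb22]
    linear_combination (x1 * Z 0 1 * Z 1 1) * e5C
  have o3 : (x ᵥ* ft t Z) 3 = w * b12 := by
    simp [vecMul, dotProduct, Fin.sum_univ_four, ft, ← hp, ← hq, ← hw, e2, e3, e4,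
      ← hx0, ← hx1, ← hx2, ← hx3]
    rw [hb12]; ring
  rw [Fin.sum_univ_four, Fin.sum_univ_four, o0, o1, o2, o3, ← hx0, ← hx1, ← hx2, ← hx3]
  have n1 : ‖(α : ℂ) * d21 + β * d12‖ ^ 2 ≤ ‖d21‖ ^ 2 + ‖d12‖ ^ 2 := by
    simpa [hαβ] using norm_add_sq_le α β d21 d12
  have n2 : ‖c21‖ ^ 2 ≤ ‖b21‖ ^ 2 + ‖x3‖ ^ 2 := by
    simpa [hqw, hc21] using norm_add_sq_le q w b21 x3
  have n3 : ‖q * b12‖ ^ 2 + ‖w * b12‖ ^ 2 = ‖b12‖ ^ 2 := by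
    simp only [norm_mul, Complex.norm_real, mul_pow, Real.norm_eq_abs, sq_abs]
    rw [← add_mul, hqw, one_mul]
  have n4 : ‖α * x1‖ ^ 2 + ‖β * x1‖ ^ 2 = ‖x1‖ ^ 2 := by
    simp only [norm_mul, Complex.norm_real, mul_pow, Real.norm_eq_abs, sq_abs]
    rw [← add_mul, hαβ, one_mul]
  have s1 := vecMul_sq_le hZ x0 (α * x1)
  have s2 := vecMul_sq_le hZ (β * x1) x2
  have s3 := vecMul_sq_le hZ b11 c21
  have s4 := vecMul_sq_le hZ (q * b12) b22
  rw [← hb11, ← hb12] at s1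
  rw [← hb21, ← hb22] at s2
  rw [← hd11, ← hd21] at s3
  rw [← hd12, ← hd22] at s4
  have hα0 : (α : ℂ) ≠ 0 := by
    rw [hα]; exact_mod_cast (one_div_pos.2 hp0).ne'
  by_cases h1 : x0 ≠ 0 ∨ (α : ℂ) * x1 ≠ 0
  · have := vecMul_sq_lt hZ h1
    rw [← hb11, ← hb12] at this
    linarith
  by_cases h2 : (β : ℂ) * x1 ≠ 0 ∨ x2 ≠ 0
  · have := vecMul_sq_lt hZ h2
    rw [← hb21, ← hb22] at this
    linarith
  by_cases h3 : b11 ≠ 0 ∨ c21 ≠ 0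
  · have := vecMul_sq_lt hZ h3
    rw [← hd11, ← hd21] at this
    linarith
  have hx3 : 0 < ‖x3‖ ^ 2 := by
    refine pow_pos (norm_pos_iff.2 fun h => hx ?_) 2
    push Not at h1 h2
    ext i
    fin_cases i
    · simpa [hx0] using h1.1
    · simpa [hx1, hα0] using h1.2
    · simpa [hx2] using h2.2
    · simpa [hx3] using h
  push Not at h3
  rw [h3.1, h3.2] at s3
  simp only [norm_zero] at s3
  have := sq_nonneg ‖b21‖
  have := sq_nonneg ‖b11‖
  linarith

theorem hasDerivAt_matrix_iff {r s : ℕ} {g : ℂ → Matrix (Fin r) (Fin s) ℂ}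
    {V : Matrix (Fin r) (Fin s) ℂ} {z : ℂ} :
    HasDerivAt g V z ↔ ∀ i j, HasDerivAt (fun ζ => g ζ i j) (V i j) z :=
  hasDerivAt_pi.trans (forall_congr' fun _ => hasDerivAt_pi)

/-- The derivative of `f_t` at `Z` in the direction `V`. -/
def dft (t : ℝ) (Z V : Matrix (Fin 2) (Fin 2) ℂ) : Matrix (Fin 4) (Fin 4) ℂ :=
  !![2 * Z 0 0 * V 0 0, (√(2 - t) : ℂ) * (V 0 0 * Z 0 1 + Z 0 0 * V 0 1),
      (√(1 - t) : ℂ) * (2 * Z 0 1 * V 0 1), (√t : ℂ) * V 0 1;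
    (√(2 - t) : ℂ) * (V 0 0 * Z 1 0 + Z 0 0 * V 1 0),
      ((2 * (1 - t) / (2 - t) : ℝ) : ℂ) * (V 0 0 * Z 1 1 + Z 0 0 * V 1 1)
        + (V 0 1 * Z 1 0 + Z 0 1 * V 1 0),
      ((2 * √((1 - t) / (2 - t)) : ℝ) : ℂ) * (V 0 1 * Z 1 1 + Z 0 1 * V 1 1),
      (√(t / (2 - t)) : ℂ) * V 1 1;
    (√(1 - t) : ℂ) * (2 * Z 1 0 * V 1 0),
      ((2 * √((1 - t) / (2 - t)) : ℝ) : ℂ) * (V 1 0 * Z 1 1 + Z 1 0 * V 1 1),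
      2 * Z 1 1 * V 1 1, 0;
    (√t : ℂ) * V 1 0, (√(t / (2 - t)) : ℂ) * V 1 1, 0, 0]

theorem hasDerivAt_ft_comp (t : ℝ) {g : ℂ → Matrix (Fin 2) (Fin 2) ℂ}
    {V : Matrix (Fin 2) (Fin 2) ℂ} {z : ℂ} (hg : HasDerivAt g V z) :
    HasDerivAt (fun ζ => ft t (g ζ)) (dft t (g z) V) z := by
  have h := hasDerivAt_matrix_iff.1 hg
  have hsq (i j) : HasDerivAt (fun ζ => g ζ i j ^ 2) (2 * g z i j * V i j) z := by
    simpa using (h i j).fun_pow 2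
  have hmul (i j k l) : HasDerivAt (fun ζ => g ζ i j * g ζ k l)
      (V i j * g z k l + g z i j * V k l) z := (h i j).mul (h k l)
  rw [hasDerivAt_matrix_iff]
  intro i j
  fin_cases i <;> fin_cases j <;> simp only [ft, dft, mul_assoc (Complex.ofReal _)]
  · exact hsq 0 0
  · exact (hmul 0 0 0 1).const_mul _
  · exact (hsq 0 1).const_mul _
  · exact (h 0 1).const_mul _
  · exact (hmul 0 0 1 0).const_mul _
  · exact ((hmul 0 0 1 1).const_mul _).add (hmul 0 1 1 0)
  · exact (hmul 0 1 1 1).const_mul _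
  · exact (h 1 1).const_mul _
  · exact (hsq 1 0).const_mul _
  · exact (hmul 1 0 1 1).const_mul _
  · exact hsq 1 1
  · exact hasDerivAt_const _ _
  · exact (h 1 0).const_mul _
  · exact (h 1 1).const_mul _
  · exact hasDerivAt_const _ _
  · exact hasDerivAt_const _ _

theorem eq_zero_of_dft_eq_zero {t : ℝ} (ht : t ∈ Set.Ioc (0 : ℝ) 1)
    {Z V : Matrix (Fin 2) (Fin 2) ℂ} (h : dft t Z V = 0) :
    V 0 1 = 0 ∧ V 1 0 = 0 ∧ V 1 1 = 0 := by
  have h1 : (√t : ℂ) ≠ 0 := Complex.ofReal_ne_zero.2 (Real.sqrt_pos.2 ht.1).ne'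
  have h2 : (√(t / (2 - t)) : ℂ) ≠ 0 := Complex.ofReal_ne_zero.2
    (Real.sqrt_pos.2 (div_pos ht.1 (by linarith [ht.2]))).ne'
  have e1 := congrFun₂ h 0 3
  have e2 := congrFun₂ h 3 0
  have e3 := congrFun₂ h 1 3
  refine ⟨?_, ?_, ?_⟩
  · simpa [dft, h1] using e1
  · simpa [dft, h1] using e2
  · simpa [dft, -Complex.ofReal_div, h2] using e3

/-- For `0 < t < 1`, the derivative of `f_t` is injective away from the origin. -/
theorem eq_zero_of_dft_eq_zero_of_ne {t : ℝ} (ht : t ∈ Set.Ioo (0 : ℝ) 1)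
    {Z V : Matrix (Fin 2) (Fin 2) ℂ} (h : dft t Z V = 0) (hV : V ≠ 0) : Z = 0 := by
  obtain ⟨v1, v2, v3⟩ := eq_zero_of_dft_eq_zero ⟨ht.1, ht.2.le⟩ h
  have v0 : V 0 0 ≠ 0 := by
    intro v0
    apply hV
    ext i j
    fin_cases i <;> fin_cases j <;> assumption
  have h1 : (√(2 - t) : ℂ) ≠ 0 :=
    Complex.ofReal_ne_zero.2 (Real.sqrt_pos.2 (by linarith [ht.2])).ne'
  have h2 : ((2 * (1 - t) / (2 - t) : ℝ) : ℂ) ≠ 0 :=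
    Complex.ofReal_ne_zero.2 (div_pos (by linarith [ht.2]) (by linarith [ht.2])).ne'
  have e1 := congrFun₂ h 0 0
  have e2 := congrFun₂ h 0 1
  have e3 := congrFun₂ h 1 0
  have e4 := congrFun₂ h 1 1
  simp only [dft, v1, v2, v3, of_apply, cons_val', cons_val_zero, cons_val_one, mul_zero,
    add_zero, Matrix.zero_apply, zero_mul, mul_eq_zero, v0, h1, h2, two_ne_zero, or_false,
    false_or] at e1 e2 e3 e4
  ext i j
  fin_cases i <;> fin_cases j <;> assumption

theorem zero_mem_OmegaI (r s : ℕ) : (0 : Matrix (Fin r) (Fin s) ℂ) ∈ OmegaI r s := by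
  simp [OmegaI, PosDef.one]

theorem hasDerivAt_smul_matrix {r s : ℕ} (V : Matrix (Fin r) (Fin s) ℂ) (z : ℂ) :
    HasDerivAt (fun ζ : ℂ => ζ • V) V z :=
  ((hasDerivAt_id z).smul_const V).congr_deriv (one_smul ℂ V)

theorem differentiableOn_smul_matrix {r s : ℕ} (V : Matrix (Fin r) (Fin s) ℂ) (S : Set ℂ) :
    DifferentiableOn ℂ (fun ζ : ℂ => ζ • V) S :=
  fun ζ _ => (hasDerivAt_smul_matrix V ζ).differentiableAt.differentiableWithinAt

/-- Differentiating a map on `Ω^I_{r,s}` along a complex line through the origin. -/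
theorem hasDerivAt_comp_smul {r s m n : ℕ}
    {φ : Matrix (Fin r) (Fin s) ℂ → Matrix (Fin m) (Fin n) ℂ}
    (hφ : DifferentiableOn ℂ φ (OmegaI r s)) {V : Matrix (Fin r) (Fin s) ℂ}
    (hV : ∀ x : Fin r → ℂ, ∑ j, ‖(x ᵥ* V) j‖ ^ 2 ≤ ∑ i, ‖x i‖ ^ 2) :
    HasDerivAt (fun ζ : ℂ => φ (ζ • V)) (fderivWithin ℂ φ (OmegaI r s) 0 V) 0 :=
  (hφ 0 (zero_mem_OmegaI r s)).hasFDerivWithinAt.comp_hasDerivAt_of_eq (0 : ℂ)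
    (hasDerivAt_smul_matrix V 0)
    (by filter_upwards [Metric.ball_mem_nhds (0 : ℂ) one_pos] with ζ hζ using smul_mem_OmegaI hV hζ)
    (zero_smul ℂ V).symm

theorem vecMul_single_sq_le {r s : ℕ} (a : Fin r) (b : Fin s) (x : Fin r → ℂ) :
    ∑ j, ‖(x ᵥ* Matrix.single a b (1 : ℂ)) j‖ ^ 2 ≤ ∑ i, ‖x i‖ ^ 2 := by
  have : ∑ j, ‖(x ᵥ* Matrix.single a b (1 : ℂ)) j‖ ^ 2 = ‖x a‖ ^ 2 := by
    rw [Finset.sum_eq_single b]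
    · simp [vecMul, dotProduct, Matrix.single_apply]
    · intro j _ hj
      simp [vecMul, dotProduct, hj.symm]
    · simp
  rw [this]
  exact Finset.single_le_sum (f := fun i => ‖x i‖ ^ 2) (fun _ _ => by positivity)
    (Finset.mem_univ a)

theorem ft_zero (t : ℝ) : ft t 0 = 0 := by
  ext i j
  fin_cases i <;> fin_cases j <;> simp [ft]

/-- `f_t = σ ∘ f_{t'} ∘ τ` on `Ω^I_{2,2}`, with `τi` inverse to `τ` and `σi` to `σ`; the role of
`σi` is recorded in the symmetric form `f_{t'} ∘ τ = σi ∘ f_t`. -/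
structure FtEquivalence (t t' : ℝ) (τ τi : Matrix (Fin 2) (Fin 2) ℂ → Matrix (Fin 2) (Fin 2) ℂ)
    (σ σi : Matrix (Fin 4) (Fin 4) ℂ → Matrix (Fin 4) (Fin 4) ℂ) : Prop where
  maps_τ : Set.MapsTo τ (OmegaI 2 2) (OmegaI 2 2)
  maps_τi : Set.MapsTo τi (OmegaI 2 2) (OmegaI 2 2)
  diff_τ : DifferentiableOn ℂ τ (OmegaI 2 2)
  diff_τi : DifferentiableOn ℂ τi (OmegaI 2 2)
  maps_σ : Set.MapsTo σ (OmegaI 4 4) (OmegaI 4 4)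
  maps_σi : Set.MapsTo σi (OmegaI 4 4) (OmegaI 4 4)
  diff_σ : DifferentiableOn ℂ σ (OmegaI 4 4)
  diff_σi : DifferentiableOn ℂ σi (OmegaI 4 4)
  τi_τ : ∀ Z ∈ OmegaI 2 2, τi (τ Z) = Z
  τ_τi : ∀ Z ∈ OmegaI 2 2, τ (τi Z) = Z
  ft_eq : ∀ Z ∈ OmegaI 2 2, ft t Z = σ (ft t' (τ Z))
  ft_τ : ∀ Z ∈ OmegaI 2 2, ft t' (τ Z) = σi (ft t Z)

namespace FtEquivalence

variable {t t' : ℝ} {τ τi : Matrix (Fin 2) (Fin 2) ℂ → Matrix (Fin 2) (Fin 2) ℂ}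
  {σ σi : Matrix (Fin 4) (Fin 4) ℂ → Matrix (Fin 4) (Fin 4) ℂ}

theorem symm (h : FtEquivalence t t' τ τi σ σi) : FtEquivalence t' t τi τ σi σ where
  maps_τ := h.maps_τi
  maps_τi := h.maps_τ
  diff_τ := h.diff_τi
  diff_τi := h.diff_τ
  maps_σ := h.maps_σi
  maps_σi := h.maps_σ
  diff_σ := h.diff_σi
  diff_σi := h.diff_σ
  τi_τ := h.τ_τi
  τ_τi := h.τi_τ
  ft_eq Z hZ := by rw [← h.ft_τ _ (h.maps_τi hZ), h.τ_τi Z hZ]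
  ft_τ Z hZ := by rw [h.ft_eq _ (h.maps_τi hZ), h.τ_τi Z hZ]

theorem fderivWithin_inv (h : FtEquivalence t t' τ τi σ σi) {V : Matrix (Fin 2) (Fin 2) ℂ}
    (hV : ∀ x : Fin 2 → ℂ, ∑ j, ‖(x ᵥ* V) j‖ ^ 2 ≤ ∑ i, ‖x i‖ ^ 2) :
    fderivWithin ℂ τi (OmegaI 2 2) (τ 0) (fderivWithin ℂ τ (OmegaI 2 2) 0 V) = V := by
  have h0 := zero_mem_OmegaI 2 2
  have hball := Metric.ball_mem_nhds (0 : ℂ) one_pos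
  have h1 := (h.diff_τi _ (h.maps_τ h0)).hasFDerivWithinAt.comp_hasDerivAt_of_eq (0 : ℂ)
    (hasDerivAt_comp_smul h.diff_τ hV)
    (by filter_upwards [hball] with ζ hζ using h.maps_τ (smul_mem_OmegaI hV hζ))
    (by rw [zero_smul])
  refine h1.unique ((hasDerivAt_smul_matrix V 0).congr_of_eventuallyEq ?_)
  filter_upwards [hball] with ζ hζ using h.τi_τ _ (smul_mem_OmegaI hV hζ)

/-- Directions along which `f_t` vanishes to second order at the origin are sent by `dτ` into the
kernel of the derivative of `f_{t'}`. -/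
theorem dft_eq_zero (h : FtEquivalence t t' τ τi σ σi) {V : Matrix (Fin 2) (Fin 2) ℂ}
    (hV : ∀ x : Fin 2 → ℂ, ∑ j, ‖(x ᵥ* V) j‖ ^ 2 ≤ ∑ i, ‖x i‖ ^ 2)
    {W : Matrix (Fin 4) (Fin 4) ℂ}
    (hW : ∀ x : Fin 4 → ℂ, ∑ j, ‖(x ᵥ* W) j‖ ^ 2 ≤ ∑ i, ‖x i‖ ^ 2)
    (hVW : ∀ ζ : ℂ, ft t (ζ • V) = ζ ^ 2 • W) :
    dft t' (τ 0) (fderivWithin ℂ τ (OmegaI 2 2) 0 V) = 0 := by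
  have h1 := hasDerivAt_ft_comp t' (hasDerivAt_comp_smul h.diff_τ hV)
  have hσ : HasDerivAt (fun ζ : ℂ => σi (ζ • W)) (fderivWithin ℂ σi (OmegaI 4 4) 0 W)
      ((0 : ℂ) ^ 2) := by
    simpa using hasDerivAt_comp_smul h.diff_σi hW
  have h2 := hσ.scomp (0 : ℂ) (hasDerivAt_pow 2 (0 : ℂ))
  rw [zero_smul] at h1
  have h3 := h1.unique (h2.congr_of_eventuallyEq ?_)
  · simpa using h3
  · filter_upwards [Metric.ball_mem_nhds (0 : ℂ) one_pos] with ζ hζ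
    rw [h.ft_τ _ (smul_mem_OmegaI hV hζ), hVW]
    rfl

theorem dft_fderivWithin_single (h : FtEquivalence t t' τ τi σ σi) :
    dft t' (τ 0) (fderivWithin ℂ τ (OmegaI 2 2) 0 (Matrix.single 0 0 1)) = 0 := by
  refine h.dft_eq_zero (vecMul_single_sq_le 0 0) (vecMul_single_sq_le 0 0) fun ζ => ?_
  ext i j
  fin_cases i <;> fin_cases j <;> simp [ft]

theorem ne_zero_left (h : FtEquivalence t t' τ τi σ σi) (ht' : t' ∈ Set.Ioc (0 : ℝ) 1) :
    t ≠ 0 := by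
  rintro rfl
  set L := fderivWithin ℂ τ (OmegaI 2 2) 0
  set Li := fderivWithin ℂ τi (OmegaI 2 2) (τ 0)
  have hi0 : Li (L (Matrix.single 0 0 1)) = Matrix.single 0 0 1 :=
    h.fderivWithin_inv (vecMul_single_sq_le 0 0)
  have hi1 : Li (L (Matrix.single 0 1 1)) = Matrix.single 0 1 1 :=
    h.fderivWithin_inv (vecMul_single_sq_le 0 1)
  have hspan {Y : Matrix (Fin 2) (Fin 2) ℂ} (hY : dft t' (τ 0) Y = 0) :
      Y = Y 0 0 • Matrix.single 0 0 1 := by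
    obtain ⟨h1, h2, h3⟩ := eq_zero_of_dft_eq_zero ht' hY
    ext i j
    fin_cases i <;> fin_cases j <;> simp [h1, h2, h3]
  have k0 := hspan h.dft_fderivWithin_single
  have k1 := hspan (h.dft_eq_zero (vecMul_single_sq_le 0 1) (vecMul_single_sq_le 0 2)
    fun ζ => by
      ext i j
      fin_cases i <;> fin_cases j <;> simp [ft])
  rw [k0, map_smul] at hi0
  rw [k1, map_smul] at hi1
  have a0 := congrFun₂ hi0 0 0
  have a1 := congrFun₂ hi0 0 1
  have b1 := congrFun₂ hi1 0 1
  simp at a0 a1 b1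
  rcases a1 with a1 | a1
  · simp [a1] at a0
  · simp [a1] at b1

theorem map_zero_eq_zero (h : FtEquivalence t t' τ τi σ σi) (ht' : t' ∈ Set.Ioo (0 : ℝ) 1) :
    τ 0 = 0 := by
  refine eq_zero_of_dft_eq_zero_of_ne ht' h.dft_fderivWithin_single fun h0 => ?_
  have h1 := h.fderivWithin_inv (vecMul_single_sq_le 0 0)
  rw [h0, map_zero] at h1
  simpa using congrFun₂ h1 0 0

/-- If the first automorphism fixes the origin, comparing the derivatives at the origin by the
Schwarz lemma bounds the parameters. -/
theorem le_of_map_zero (h : FtEquivalence t t' τ τi σ σi) (ht : t ∈ Set.Ioc (0 : ℝ) 1)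
    (h0 : τ 0 = 0) : t' ≤ t := by
  have hτi0 : τi 0 = 0 := by simpa [h0] using h.τi_τ 0 (zero_mem_OmegaI 2 2)
  have hσi0 : σi 0 = 0 := by
    simpa [h0, ft_zero] using (h.ft_τ 0 (zero_mem_OmegaI 2 2)).symm
  have hc := vecMul_single_sq_le (0 : Fin 2) (1 : Fin 2)
  have hg := hasDerivAt_comp_smul h.diff_τi hc
  set V := fderivWithin ℂ τi (OmegaI 2 2) 0 (Matrix.single 0 1 1)
  have hV := schwarz_OmegaI
    (h.diff_τi.comp (differentiableOn_smul_matrix _ _) fun ζ hζ => smul_mem_OmegaI hc hζ)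
    (fun ζ hζ => h.maps_τi (smul_mem_OmegaI hc hζ)) (by simp [hτi0]) hg
  set w := √t with hw
  have hw0 : 0 < w := Real.sqrt_pos.2 ht.1
  have hwC : (w : ℂ) ≠ 0 := Complex.ofReal_ne_zero.2 hw0.ne'
  set p := √(2 - t) with hp
  have hp1 : 1 ≤ p := Real.one_le_sqrt.2 (by linarith [ht.2])
  have hpC : (p : ℂ) ≠ 0 := Complex.ofReal_ne_zero.2 (by positivity)
  have hdiv : √(t / (2 - t)) = w / p := sqrt_div_two_sub ht.1.le
  set W : Matrix (Fin 4) (Fin 4) ℂ := (w : ℂ)⁻¹ • dft t 0 V with hWdef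
  have hW (x : Fin 4 → ℂ) : ∑ j, ‖(x ᵥ* W) j‖ ^ 2 ≤ ∑ i, ‖x i‖ ^ 2 := by
    have v1 := hV ![0, 1]
    have v2 := hV ![x 0, x 1 / p]
    simp [Fin.sum_univ_two, vecMul, dotProduct] at v1 v2
    have o0 : (x ᵥ* W) 0 = x 3 * V 1 0 := by
      simp [hWdef, dft, vecMul, dotProduct, Fin.sum_univ_four, ← hw]
      field_simp
      simp
    have o1 : (x ᵥ* W) 1 = x 3 * (V 1 1 / p) := by
      simp [hWdef, dft, vecMul, dotProduct, Fin.sum_univ_four, hdiv]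
      field_simp
      simp
    have o2 : (x ᵥ* W) 2 = 0 := by
      simp [hWdef, dft, vecMul, dotProduct, Fin.sum_univ_four]
    have o3 : (x ᵥ* W) 3 = x 0 * V 0 1 + x 1 / p * V 1 1 := by
      simp [hWdef, dft, vecMul, dotProduct, Fin.sum_univ_four, hdiv, ← hw]
      field_simp
    have hdp (z : ℂ) : ‖z / p‖ ^ 2 ≤ ‖z‖ ^ 2 := by
      rw [norm_div, Complex.norm_real, Real.norm_of_nonneg (by positivity)]
      gcongr
      exact div_le_self (norm_nonneg _) hp1
    rw [Fin.sum_univ_four, Fin.sum_univ_four, o0, o1, o2, o3, norm_mul, norm_mul, mul_pow, mul_pow]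
    have d1 := hdp (V 1 1)
    have d2 := hdp (x 1)
    rw [norm_div, Complex.norm_real, Real.norm_eq_abs] at d2
    simp only [norm_zero]
    have e1 := mul_le_mul_of_nonneg_left (add_le_add_right d1 (‖V 1 0‖ ^ 2) |>.trans v1)
      (sq_nonneg ‖x 3‖)
    have e2 := sq_nonneg ‖x 0 * V 0 0 + x 1 / p * V 1 0‖
    have e3 := sq_nonneg ‖x 2‖
    linarith
  have hσ := hasDerivAt_comp_smul h.diff_σi hW
  have hS := schwarz_OmegaI
    (h.diff_σi.comp (differentiableOn_smul_matrix W _) fun ζ hζ => smul_mem_OmegaI hW hζ)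
    (fun ζ hζ => h.maps_σi (smul_mem_OmegaI hW hζ)) (by simp [hσi0]) hσ
  have hchain : fderivWithin ℂ σi (OmegaI 4 4) 0 (dft t 0 V) =
      dft t' 0 (Matrix.single 0 1 1) := by
    have hf := hasDerivAt_ft_comp t hg
    have hf' := hasDerivAt_ft_comp t' (hasDerivAt_smul_matrix (Matrix.single (0 : Fin 2) 1 1) 0)
    rw [zero_smul] at hf hf'
    rw [hτi0] at hf
    have hball := Metric.ball_mem_nhds (0 : ℂ) one_pos
    have hs := (h.diff_σi 0
      (zero_mem_OmegaI 4 4)).hasFDerivWithinAt.comp_hasDerivAt_of_eq (0 : ℂ) hf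
      (by filter_upwards [hball] with ζ hζ using
        ft_mapsTo ⟨ht.1.le, ht.2⟩ (h.maps_τi (smul_mem_OmegaI hc hζ)))
      (by simp [hτi0, ft_zero])
    refine hs.unique (hf'.congr_of_eventuallyEq ?_)
    filter_upwards [hball] with ζ hζ
    have hm := smul_mem_OmegaI hc hζ
    rw [Function.comp_apply, ← h.ft_τ _ (h.maps_τi hm), h.τ_τi _ hm]
  have hfin := hS (Pi.single 0 1)
  rw [hWdef, map_smul, hchain] at hfin
  simp [Fin.sum_univ_four, dft] at hfin
  rw [abs_of_pos hw0, abs_of_nonneg (Real.sqrt_nonneg _), ← div_eq_inv_mul, div_le_one hw0] at hfin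
  exact (Real.sqrt_le_sqrt_iff ht.1.le).1 hfin

end FtEquivalence

/-- Corollary 4.2: the maps `f_t`, `t ∈ [0,1]`, are pairwise inequivalent. -/
theorem ft_inequivalent (t t' : ℝ)
    (ht : t ∈ Set.Icc (0 : ℝ) 1) (ht' : t' ∈ Set.Icc (0 : ℝ) 1) (htt' : t ≠ t') :
    ¬ ∃ τ σ, IsAutomorphismOf (OmegaI 2 2) τ ∧ IsAutomorphismOf (OmegaI 4 4) σ ∧
      ∀ Z ∈ OmegaI 2 2, ft t Z = σ (ft t' (τ Z)) := by
  rintro ⟨τ, σ, ⟨hτ, dτ, τi, hτi, dτi, τiτ, ττi⟩, ⟨hσ, dσ, σi, hσi, dσi, σiσ, σσi⟩, heq⟩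
  have h : FtEquivalence t t' τ τi σ σi :=
    { maps_τ := hτ, maps_τi := hτi, diff_τ := dτ, diff_τi := dτi
      maps_σ := hσ, maps_σi := hσi, diff_σ := dσ, diff_σi := dσi
      τi_τ := τiτ, τ_τi := ττi, ft_eq := heq
      ft_τ := fun Z hZ => by rw [heq Z hZ, σiσ _ (ft_mapsTo ht' (hτ hZ))] }
  have h0 : t ≠ 0 := fun h0 =>
    h.ne_zero_left ⟨ht'.1.lt_of_ne fun h' => htt' (h0.trans h'), ht'.2⟩ h0
  have h0' : t' ≠ 0 := h.symm.ne_zero_left ⟨ht.1.lt_of_ne' h0, ht.2⟩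
  have hpos : t ∈ Set.Ioc (0 : ℝ) 1 := ⟨ht.1.lt_of_ne' h0, ht.2⟩
  have hpos' : t' ∈ Set.Ioc (0 : ℝ) 1 := ⟨ht'.1.lt_of_ne' h0', ht'.2⟩
  have hτ0 : τ 0 = 0 ∧ τi 0 = 0 := by
    rcases lt_or_gt_of_ne htt' with hlt | hlt
    · have hτi0 := h.symm.map_zero_eq_zero ⟨hpos.1, hlt.trans_le ht'.2⟩
      exact ⟨by simpa [hτi0] using ττi 0 (zero_mem_OmegaI 2 2), hτi0⟩
    · have hτ0 := h.map_zero_eq_zero ⟨hpos'.1, hlt.trans_le ht.2⟩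
      exact ⟨hτ0, by simpa [hτ0] using τiτ 0 (zero_mem_OmegaI 2 2)⟩
  exact htt' ((h.symm.le_of_map_zero hpos' hτ0.2).antisymm (h.le_of_map_zero hpos hτ0.1))
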